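/- Let 0<r₀<r₁, δ>0, k≥1 an integer, and 𝓜={x∈ℝ³ : r₀<|x|<r₁}. Let u:cl(𝓜)→ℝ³ be k-times continuously differentiable with u(x)·x/|x| ≥ δ for all x∈cl(𝓜), let a,f:cl(𝓜)→ℝ be k-times continuously differentiable, and let E₀:ℝ³→ℝ be k-times continuously differentiable. Then there exists exactly one k-times continuously differentiable function E:cl(𝓜)→ℝ satisfying the transport equation u·∇E + aE = f in 𝓜 and the initial condition E(x)=E₀(x) for all x with |x|=r₀. -/

import Mathlib

open scoped BigOperators

/-- Euclidean norm on `Fin 3 → ℝ`. -/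
noncomputable def enorm3 (x : Fin 3 → ℝ) : ℝ := Real.sqrt (∑ i, (x i) ^ 2)

/-- Partial derivative `∂ⱼ f` at `x`. -/
noncomputable def pd (j : Fin 3) (f : (Fin 3 → ℝ) → ℝ) (x : Fin 3 → ℝ) : ℝ :=
  fderiv ℝ f x (Pi.single j 1)

section PathSpace

variable {K : Type} [TopologicalSpace K] [CompactSpace K]
  {E F : Type} [NormedAddCommGroup E] [NormedSpace ℝ E] [NormedAddCommGroup F] [NormedSpace ℝ F]

/-- Pointwise application of a path of operators to a path of vectors, as a bounded bilinear map. -/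
noncomputable def pointwiseApply :
    C(K, E →L[ℝ] F) →L[ℝ] C(K, E) →L[ℝ] C(K, F) :=
  LinearMap.mkContinuous₂
    (LinearMap.mk₂ ℝ (fun (A : C(K, E →L[ℝ] F)) (γ : C(K, E)) =>
        (⟨fun s => A s (γ s), A.continuous.clm_apply γ.continuous⟩ : C(K, F)))
      (by intros; ext; simp) (by intros; ext; simp) (by intros; ext; simp) (by intros; ext; simp))
    1 (by
      intro A γ
      rw [one_mul, ContinuousMap.norm_le _ (by positivity)]
      intro s
      refine ((A s).le_opNorm _).trans ?_
      gcongr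
      · exact A.norm_coe_le_norm s
      · exact γ.norm_coe_le_norm s)

theorem hasFDerivAt_postcomp {g : E → F} {g' : E → E →L[ℝ] F} (hg : Continuous g)
    (hg' : Continuous g') (h : ∀ x, HasFDerivAt g (g' x) x) (γ : C(K, E)) :
    HasFDerivAt (fun η : C(K, E) => ContinuousMap.comp ⟨g, hg⟩ η)
      (pointwiseApply (ContinuousMap.comp ⟨g', hg'⟩ γ)) γ := by
  rw [hasFDerivAt_iff_isLittleO_nhds_zero, Asymptotics.isLittleO_iff]
  intro c hc
  have hcont : Continuous fun η : C(K, E) => ContinuousMap.comp ⟨g', hg'⟩ η :=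
    ContinuousMap.continuous_postcomp _
  obtain ⟨d, hd, hball⟩ := (Metric.continuousAt_iff
    (f := fun η : C(K, E) => ContinuousMap.comp ⟨g', hg'⟩ η) (a := γ)).1 hcont.continuousAt c hc
  filter_upwards [Metric.ball_mem_nhds (0 : C(K, E)) hd] with v hv
  rw [ContinuousMap.norm_le _ (by positivity)]
  intro s
  have key : ‖g (γ s + v s) - g (γ s) - g' (γ s) (γ s + v s - γ s)‖ ≤
      c * ‖γ s + v s - γ s‖ := by
    refine Convex.norm_image_sub_le_of_norm_hasFDerivWithin_le' (s := segment ℝ (γ s) (γ s + v s))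
      (f' := g') (fun x _ => (h x).hasFDerivWithinAt) ?_ (convex_segment _ _)
      (left_mem_segment _ _ _) (right_mem_segment _ _ _)
    intro x hx
    rw [segment_eq_image'] at hx
    obtain ⟨θ, hθ, rfl⟩ := hx
    have hmem : dist (γ + θ • v) γ < d := by
      rw [dist_eq_norm, add_sub_cancel_left, norm_smul, Real.norm_of_nonneg hθ.1]
      rw [mem_ball_zero_iff] at hv
      exact (mul_le_of_le_one_left (norm_nonneg _) hθ.2).trans_lt hv
    have := (ContinuousMap.dist_apply_le_dist s).trans (hball hmem).le
    rw [dist_eq_norm] at this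
    simpa using this
  rw [add_sub_cancel_left] at key
  exact key.trans (by gcongr; exact v.norm_coe_le_norm s)

theorem contDiff_postcomp {k : ℕ} {g : E → F} (hgc : Continuous g) (hg : ContDiff ℝ k g) :
    ContDiff ℝ k (fun η : C(K, E) => ContinuousMap.comp ⟨g, hgc⟩ η) := by
  induction k generalizing F with
  | zero =>
    rw [Nat.cast_zero, contDiff_zero]
    exact ContinuousMap.continuous_postcomp _
  | succ n ih =>
    rw [Nat.cast_succ, contDiff_succ_iff_hasFDerivAt]
    rw [Nat.cast_succ, contDiff_succ_iff_hasFDerivAt] at hg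
    obtain ⟨g', hg', h⟩ := hg
    exact ⟨_, pointwiseApply.contDiff.comp (ih hg'.continuous hg'),
      hasFDerivAt_postcomp hgc hg'.continuous h⟩

end PathSpace

section FixedPoint

variable {P X : Type} [NormedAddCommGroup P] [NormedSpace ℝ P] [CompleteSpace P]
  [NormedAddCommGroup X] [NormedSpace ℝ X] [CompleteSpace X]

/-- The fixed point of a `Cᵏ` family of uniform contractions depends `Cᵏ` on the parameter. -/
theorem contDiffOn_fixedPoint {k : ℕ} (hk : 1 ≤ k) {G : P × X → X} (hG : ContDiff ℝ k G)
    {U : Set P} (hU : IsOpen U) {c : NNReal} (hc : c < 1)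
    (hlip : ∀ p ∈ U, LipschitzWith c fun x => G (p, x)) :
    ∃ η : P → X, ContDiffOn ℝ k η U ∧ (∀ p ∈ U, G (p, η p) = η p) ∧
      ∀ p ∈ U, ∀ x, G (p, x) = x → x = η p := by
  classical
  have hcon : ∀ p ∈ U, ContractingWith c fun x => G (p, x) := fun p hp => ⟨hc, hlip p hp⟩
  have huniq : ∀ p ∈ U, ∀ x y, G (p, x) = x → G (p, y) = y → x = y := fun p hp x y hx hy =>
    (hcon p hp).fixedPoint_unique' hx hy
  refine ⟨fun p => if hp : p ∈ U then ContractingWith.fixedPoint _ (hcon p hp) else 0, ?_, ?_, ?_⟩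
  swap
  · intro p hp
    simp only [dif_pos hp]
    exact (hcon p hp).fixedPoint_isFixedPt
  swap
  · intro p hp x hx
    simp only [dif_pos hp]
    exact (hcon p hp).fixedPoint_unique hx
  set η : P → X := fun p => if hp : p ∈ U then ContractingWith.fixedPoint _ (hcon p hp) else 0
    with hη
  have hfix : ∀ p ∈ U, G (p, η p) = η p := by
    intro p hp
    simp only [hη, dif_pos hp]
    exact (hcon p hp).fixedPoint_isFixedPt
  intro p hp
  refine ContDiffAt.contDiffWithinAt ?_
  have hk0 : (k : WithTop ℕ∞) ≠ 0 := by exact_mod_cast (by omega : k ≠ 0)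
  set f : P × X → X := fun v => v.2 - G v with hf
  have cdf : ContDiffAt ℝ k f (p, η p) := (contDiff_snd.sub hG).contDiffAt
  have hdG : HasFDerivAt G (fderiv ℝ G (p, η p)) (p, η p) :=
    (hG.differentiable hk0 _).hasFDerivAt
  have hinv : (fderiv ℝ f (p, η p) ∘L .inr ℝ P X).IsInvertible := by
    have h1 : fderiv ℝ f (p, η p) ∘L .inr ℝ P X =
        1 - fderiv ℝ G (p, η p) ∘L .inr ℝ P X := by
      rw [show fderiv ℝ f (p, η p) = .snd ℝ P X - fderiv ℝ G (p, η p) from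
        (hasFDerivAt_snd.sub hdG).fderiv]
      ext x
      simp
    have h2 : ‖fderiv ℝ G (p, η p) ∘L .inr ℝ P X‖ ≤ c := by
      have h3 : HasFDerivAt (fun x => G (p, x)) (fderiv ℝ G (p, η p) ∘L .inr ℝ P X) (η p) :=
        HasFDerivAt.comp (η p) hdG (hasFDerivAt_prodMk_right p (η p))
      rw [← h3.fderiv]
      exact norm_fderiv_le_of_lipschitz ℝ (hlip p hp)
    have h4 := isUnit_one_sub_of_norm_lt_one (h2.trans_lt (by exact_mod_cast hc))
    rw [h1]
    obtain ⟨e, he⟩ := h4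
    exact ⟨ContinuousLinearEquiv.unitsEquiv ℝ X e, by rw [← he]; rfl⟩
  refine (cdf.contDiffAt_implicitFunction hk0 hinv).congr_of_eventuallyEq ?_
  filter_upwards [cdf.eventually_apply_implicitFunction hk0 hinv, hU.mem_nhds hp] with q hq hqU
  refine huniq q hqU _ _ (hfix q hqU) ?_
  have h5 : f (p, η p) = 0 := by simp [hf, hfix p hp]
  rw [h5] at hq
  exact (sub_eq_zero.1 hq).symm

end FixedPoint

section Flow

open Set

variable {Z : Type} [NormedAddCommGroup Z]

/-- The extension of a path on the unit interval to the real line by constants. -/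
noncomputable def pathExtend (γ : C(Icc (0 : ℝ) 1, Z)) : ℝ → Z := IccExtend zero_le_one γ

theorem continuous_pathExtend (γ : C(Icc (0 : ℝ) 1, Z)) : Continuous (pathExtend γ) :=
  γ.continuous.Icc_extend'

theorem pathExtend_coe (γ : C(Icc (0 : ℝ) 1, Z)) (s : Icc (0 : ℝ) 1) : pathExtend γ s = γ s :=
  IccExtend_val _ _ _

theorem norm_pathExtend_le (γ : C(Icc (0 : ℝ) 1, Z)) (s : ℝ) : ‖pathExtend γ s‖ ≤ ‖γ‖ :=
  γ.norm_coe_le_norm _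

theorem pathExtend_comp {Y : Type} [NormedAddCommGroup Y] (f : C(Z, Y))
    (γ : C(Icc (0 : ℝ) 1, Z)) (s : ℝ) : pathExtend (f.comp γ) s = f (pathExtend γ s) := rfl

variable [NormedSpace ℝ Z]

/-- The embedding of vectors as constant paths. -/
noncomputable def constPath : Z →L[ℝ] C(Icc (0 : ℝ) 1, Z) :=
  LinearMap.mkContinuous
    { toFun := fun z => ContinuousMap.const _ z
      map_add' := by intros; ext; simp
      map_smul' := by intros; ext; simp } 1
    (by
      intro z
      rw [one_mul, ContinuousMap.norm_le _ (norm_nonneg _)]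
      intro s
      simp)

theorem constPath_apply (z : Z) (s : Icc (0 : ℝ) 1) : constPath z s = z := rfl

/-- The Volterra operator `γ ↦ (s ↦ ∫₀ˢ γ)`. -/
noncomputable def volterra : C(Icc (0 : ℝ) 1, Z) →L[ℝ] C(Icc (0 : ℝ) 1, Z) :=
  LinearMap.mkContinuous
    { toFun := fun γ => ⟨fun s => ∫ σ in (0 : ℝ)..s, pathExtend γ σ,
        (intervalIntegral.continuous_primitive
          (fun a b => (continuous_pathExtend γ).intervalIntegrable a b) 0).comp
          continuous_subtype_val⟩
      map_add' := by
        intro γ η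
        ext s
        exact intervalIntegral.integral_add ((continuous_pathExtend γ).intervalIntegrable _ _)
          ((continuous_pathExtend η).intervalIntegrable _ _)
      map_smul' := by
        intro c γ
        ext s
        exact intervalIntegral.integral_smul c _ } 1
    (by
      intro γ
      rw [one_mul, ContinuousMap.norm_le _ (norm_nonneg _)]
      intro s
      refine (intervalIntegral.norm_integral_le_of_norm_le_const
        (fun σ _ => norm_pathExtend_le γ σ)).trans ?_
      rw [sub_zero, abs_of_nonneg s.2.1]
      exact mul_le_of_le_one_right (norm_nonneg _) s.2.2)

theorem volterra_apply (γ : C(Icc (0 : ℝ) 1, Z)) (s : Icc (0 : ℝ) 1) :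
    volterra γ s = ∫ σ in (0 : ℝ)..s, pathExtend γ σ := rfl

/-- Multiplication of a path by a scalar weight. -/
noncomputable def weightPath (w : C(Icc (0 : ℝ) 1, ℝ)) :
    C(Icc (0 : ℝ) 1, Z) →L[ℝ] C(Icc (0 : ℝ) 1, Z) :=
  pointwiseApply ⟨fun s => w s • ContinuousLinearMap.id ℝ Z, by fun_prop⟩

theorem weightPath_apply (w : C(Icc (0 : ℝ) 1, ℝ)) (γ : C(Icc (0 : ℝ) 1, Z))
    (s : Icc (0 : ℝ) 1) : weightPath w γ s = w s • γ s := rfl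

theorem norm_volterra_comp_sub_le {W : Z → Z} {L : NNReal} (hL : LipschitzWith L W)
    (hc : Continuous W) {l : ℝ} (hl : 0 < l) (w : C(Icc (0 : ℝ) 1, ℝ))
    (hw : ∀ s, w s = Real.exp (l * s)) (η ζ : C(Icc (0 : ℝ) 1, Z)) (s : Icc (0 : ℝ) 1) :
    ‖volterra (ContinuousMap.comp ⟨W, hc⟩ (weightPath w η)) s -
      volterra (ContinuousMap.comp ⟨W, hc⟩ (weightPath w ζ)) s‖ ≤
      L / l * Real.exp (l * s) * ‖η - ζ‖ := by
  rw [volterra_apply, volterra_apply, ← intervalIntegral.integral_sub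
    ((continuous_pathExtend _).intervalIntegrable _ _)
    ((continuous_pathExtend _).intervalIntegrable _ _)]
  have hderiv : ∀ σ : ℝ, HasDerivAt (fun σ => L / l * Real.exp (l * σ) * ‖η - ζ‖)
      (L * Real.exp (l * σ) * ‖η - ζ‖) σ := by
    intro σ
    have := ((((hasDerivAt_id σ).const_mul l).exp).const_mul ((L : ℝ) / l)).mul_const ‖η - ζ‖
    exact this.congr_deriv (by simp only [id]; field_simp)
  have hint : ∫ σ in (0 : ℝ)..s, L * Real.exp (l * σ) * ‖η - ζ‖ =
      L / l * Real.exp (l * s) * ‖η - ζ‖ - L / l * Real.exp (l * 0) * ‖η - ζ‖ :=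
    intervalIntegral.integral_eq_sub_of_hasDerivAt (fun σ _ => hderiv σ)
      (Continuous.intervalIntegrable (by fun_prop) _ _)
  refine (intervalIntegral.norm_integral_le_of_norm_le s.2.1
    (g := fun σ => L * Real.exp (l * σ) * ‖η - ζ‖) ?_
    (Continuous.intervalIntegrable (by fun_prop) _ _)).trans ?_
  · refine Filter.Eventually.of_forall fun σ hσ => ?_
    have hσ' : σ ∈ Icc (0 : ℝ) 1 := ⟨hσ.1.le, hσ.2.trans s.2.2⟩
    have e : ∀ γ : C(Icc (0 : ℝ) 1, Z),
        pathExtend (ContinuousMap.comp ⟨W, hc⟩ (weightPath w γ)) σ =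
          W (Real.exp (l * σ) • γ ⟨σ, hσ'⟩) := by
      intro γ
      rw [← hw ⟨σ, hσ'⟩]
      exact pathExtend_coe _ ⟨σ, hσ'⟩
    rw [e, e]
    refine (hL.norm_sub_le _ _).trans ?_
    rw [← smul_sub, norm_smul, Real.norm_of_nonneg (Real.exp_pos _).le, mul_assoc]
    gcongr
    exact (η - ζ).norm_coe_le_norm ⟨σ, hσ'⟩
  · rw [hint]
    have : 0 ≤ L / l * Real.exp (l * 0) * ‖η - ζ‖ := by positivity
    linarith

variable [CompleteSpace Z]

/-- The flow of a globally Lipschitz `Cᵏ` vector field `W`: paths over the unit interval solving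
`γ' = τ W(γ)`, depending `Cᵏ` on the initial value and on the speed `τ`. -/
theorem exists_flow {k : ℕ} (hk : 1 ≤ k) {W : Z → Z} (hW : ContDiff ℝ k W)
    (hc : Continuous W) {L : NNReal} (hL : LipschitzWith L W) {T : ℝ} (hT : 0 < T) :
    ∃ Γ : Z × ℝ → C(Icc (0 : ℝ) 1, Z), ContDiffOn ℝ k Γ {p | |p.2| < T} ∧
      ∀ p : Z × ℝ, |p.2| < T → ∀ γ,
        (γ = constPath p.1 + p.2 • volterra (ContinuousMap.comp ⟨W, hc⟩ γ) ↔ γ = Γ p) := by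
  set l : ℝ := 2 * T * L + 1 with hl_def
  have hl : 0 < l := by positivity
  let w : C(Icc (0 : ℝ) 1, ℝ) := ⟨fun s => Real.exp (l * s), by fun_prop⟩
  let w' : C(Icc (0 : ℝ) 1, ℝ) := ⟨fun s => Real.exp (-(l * s)), by fun_prop⟩
  have hw : ∀ s, w s = Real.exp (l * s) := fun s => rfl
  have hw' : ∀ s, w' s = Real.exp (-(l * s)) := fun s => rfl
  have hww' : ∀ γ : C(Icc (0 : ℝ) 1, Z), weightPath w (weightPath w' γ) = γ := by
    intro γ
    ext s
    rw [weightPath_apply, weightPath_apply, smul_smul, hw, hw', ← Real.exp_add]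
    simp
  have hw'w : ∀ γ : C(Icc (0 : ℝ) 1, Z), weightPath w' (weightPath w γ) = γ := by
    intro γ
    ext s
    rw [weightPath_apply, weightPath_apply, smul_smul, hw, hw', ← Real.exp_add]
    simp
  let G : (Z × ℝ) × C(Icc (0 : ℝ) 1, Z) → C(Icc (0 : ℝ) 1, Z) := fun v =>
    weightPath w' (constPath v.1.1 +
      v.1.2 • volterra (ContinuousMap.comp ⟨W, hc⟩ (weightPath w v.2)))
  have hG : ContDiff ℝ k G := by
    have h1 : ContDiff ℝ k fun v : (Z × ℝ) × C(Icc (0 : ℝ) 1, Z) =>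
        volterra (ContinuousMap.comp ⟨W, hc⟩ (weightPath w v.2)) :=
      volterra.contDiff.comp ((contDiff_postcomp hc hW).comp
        ((weightPath w).contDiff.comp contDiff_snd))
    have h2 : ContDiff ℝ k fun v : (Z × ℝ) × C(Icc (0 : ℝ) 1, Z) => constPath v.1.1 :=
      constPath.contDiff.comp (f := fun v : (Z × ℝ) × C(Icc (0 : ℝ) 1, Z) => v.1.1)
        contDiff_fst.fst
    exact (weightPath w').contDiff.comp (h2.add (contDiff_fst.snd.smul h1))
  have hU : IsOpen {p : Z × ℝ | |p.2| < T} := isOpen_lt (by fun_prop) continuous_const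
  obtain ⟨η, hη, hfix, huniq⟩ := contDiffOn_fixedPoint hk hG hU
    (c := 1 / 2) (by rw [← NNReal.coe_lt_coe]; norm_num) (by
      intro p hp
      refine LipschitzWith.of_dist_le_mul fun x y => ?_
      rw [ContinuousMap.dist_le (by positivity)]
      intro s
      have hp' : |p.2| < T := hp
      have hmain := norm_volterra_comp_sub_le hL hc hl w hw x y s
      simp only [G, weightPath_apply, ContinuousMap.add_apply, ContinuousMap.smul_apply]
      rw [dist_eq_norm, dist_eq_norm, ← smul_sub, add_sub_add_left_eq_sub, ← smul_sub, norm_smul,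
        norm_smul, hw', Real.norm_of_nonneg (Real.exp_pos _).le, Real.norm_eq_abs]
      calc Real.exp (-(l * s)) * (|p.2| * _) ≤
          Real.exp (-(l * s)) * (T * (L / l * Real.exp (l * s) * ‖x - y‖)) := by gcongr
        _ = (Real.exp (-(l * s)) * Real.exp (l * s)) * (T * L / l) * ‖x - y‖ := by ring
        _ = (T * L / l) * ‖x - y‖ := by rw [← Real.exp_add]; simp
        _ ≤ _ := by
          gcongr
          rw [div_le_iff₀ hl]
          push_cast
          linarith)
  refine ⟨fun p => weightPath w (η p), (weightPath (Z := Z) w).contDiff.comp_contDiffOn hη, ?_⟩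
  intro p hp γ
  beta_reduce
  constructor
  · intro h
    rw [← huniq p hp (weightPath w' γ) ?_, hww']
    simp only [G]
    rw [hww', ← h]
  · rintro rfl
    conv_lhs => rw [← hfix p hp]
    simp only [G]
    rw [hww']

end Flow

section Characteristics

open Set

variable {Z : Type} [NormedAddCommGroup Z] [NormedSpace ℝ Z]

/-- A characteristic curve `γ` of the field `W`, run with speed `τ` over the unit interval, together
with a solution `e` of the linear equation `e' = τ (F - A e)` along it. -/
structure IsCharacteristic (W : Z → Z) (A F : Z → ℝ) (τ : ℝ) (γ : ℝ → Z) (e : ℝ → ℝ) : Prop where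
  continuousOn_curve : ContinuousOn γ (Icc 0 1)
  continuousOn_value : ContinuousOn e (Icc 0 1)
  hasDerivAt_curve : ∀ s ∈ Ioo (0 : ℝ) 1, HasDerivAt γ (τ • W (γ s)) s
  hasDerivAt_value : ∀ s ∈ Ioo (0 : ℝ) 1, HasDerivAt e (τ * (F (γ s) - A (γ s) * e s)) s

theorem IsCharacteristic.comp_affine {W : Z → Z} {A F : Z → ℝ} {τ : ℝ} {γ : ℝ → Z} {e : ℝ → ℝ}
    (h : IsCharacteristic W A F τ γ e) {t : ℝ} (ht : t ∈ Ico (0 : ℝ) 1) :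
    IsCharacteristic W A F ((1 - t) * τ) (fun s => γ (t + (1 - t) * s))
      (fun s => e (t + (1 - t) * s)) := by
  have hIcc : MapsTo (fun s : ℝ => t + (1 - t) * s) (Icc 0 1) (Icc 0 1) := by
    intro s hs
    constructor <;> nlinarith [hs.1, hs.2, ht.1, ht.2]
  have hIoo : MapsTo (fun s : ℝ => t + (1 - t) * s) (Ioo 0 1) (Ioo 0 1) := by
    intro s hs
    constructor <;> nlinarith [hs.1, hs.2, ht.1, ht.2]
  have hd : ∀ s : ℝ, HasDerivAt (fun s : ℝ => t + (1 - t) * s) (1 - t) s := by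
    intro s
    simpa using ((hasDerivAt_id s).const_mul (1 - t)).const_add t
  refine ⟨h.continuousOn_curve.comp (by fun_prop) hIcc,
    h.continuousOn_value.comp (by fun_prop) hIcc, ?_, ?_⟩
  · intro s hs
    have := (h.hasDerivAt_curve _ (hIoo hs)).scomp s (hd s)
    rwa [smul_smul] at this
  · intro s hs
    have := (h.hasDerivAt_value _ (hIoo hs)).scomp s (hd s)
    rwa [smul_eq_mul, ← mul_assoc] at this

theorem hasDerivAt_primitive {Y : Type} [NormedAddCommGroup Y] [NormedSpace ℝ Y] [CompleteSpace Y]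
    {f : ℝ → Y} (hf : Continuous f) (s : ℝ) :
    HasDerivAt (fun s => ∫ σ in (0 : ℝ)..s, f σ) (f s) s :=
  intervalIntegral.integral_hasDerivAt_right (hf.intervalIntegrable _ _)
    (hf.stronglyMeasurableAtFilter _ _) hf.continuousAt

variable [CompleteSpace Z]

/-- Solving the linear equation `e' = τ (F - A e)` along characteristics, backwards from a terminal
value: the resulting initial value depends `Cᵏ` on the starting point and on the speed. -/
theorem exists_contDiffOn_characteristic_value {k : ℕ} (hk : 1 ≤ k) {W : Z → Z} {A F D : Z → ℝ}
    (hW : ContDiff ℝ k W) {L : NNReal} (hL : LipschitzWith L W) (hA : ContDiff ℝ k A)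
    (hF : ContDiff ℝ k F) (hD : ContDiff ℝ k D) {T : ℝ} (hT : 0 < T) :
    ∃ V : Z × ℝ → ℝ, ContDiffOn ℝ k V {p | |p.2| < T} ∧
      (∀ τ, |τ| < T → ∀ γ e, IsCharacteristic W A F τ γ e → e 1 = D (γ 1) → V (γ 0, τ) = e 0) ∧
      ∀ z τ, |τ| < T → ∃ γ e, IsCharacteristic W A F τ γ e ∧ e 1 = D (γ 1) ∧ γ 0 = z := by
  have hWc := hW.continuous
  have hAc := hA.continuous
  have hFc := hF.continuous
  obtain ⟨Γ, hΓ, hΓiff⟩ := exists_flow hk hW hWc hL hT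
  let o : Icc (0 : ℝ) 1 := ⟨1, right_mem_Icc.2 zero_le_one⟩
  let P : Z × ℝ → C(Icc (0 : ℝ) 1, ℝ) := fun p =>
    p.2 • volterra (ContinuousMap.comp ⟨A, hAc⟩ (Γ p))
  let Q : Z × ℝ → C(Icc (0 : ℝ) 1, ℝ) := fun p =>
    ContinuousMap.comp ⟨Real.exp, Real.continuous_exp⟩ (P p)
  let R : Z × ℝ → C(Icc (0 : ℝ) 1, ℝ) := fun p =>
    volterra (ContinuousMap.comp ⟨F, hFc⟩ (Γ p) * Q p)
  let V : Z × ℝ → ℝ := fun p => D (Γ p o) * Q p o - p.2 * R p o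
  have hev : ∀ {Y : Type} [NormedAddCommGroup Y] [NormedSpace ℝ Y] {g : Z × ℝ → C(Icc (0 : ℝ) 1, Y)},
      ContDiffOn ℝ k g {p | |p.2| < T} → ContDiffOn ℝ k (fun p => g p o) {p | |p.2| < T} := by
    intro Y _ _ g hg
    exact (ContinuousMap.evalCLM (M := Y) ℝ o).contDiff.comp_contDiffOn hg
  have hP : ContDiffOn ℝ k P {p | |p.2| < T} :=
    contDiffOn_snd.smul ((volterra (Z := ℝ)).contDiff.comp_contDiffOn
      ((contDiff_postcomp hAc hA).comp_contDiffOn hΓ))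
  have hQ : ContDiffOn ℝ k Q {p | |p.2| < T} :=
    (contDiff_postcomp Real.continuous_exp Real.contDiff_exp).comp_contDiffOn hP
  have hR : ContDiffOn ℝ k R {p | |p.2| < T} :=
    (volterra (Z := ℝ)).contDiff.comp_contDiffOn
      (((contDiff_postcomp hFc hF).comp_contDiffOn hΓ).mul hQ)
  have hV : ContDiffOn ℝ k V {p | |p.2| < T} :=
    ((hD.comp_contDiffOn (hev hΓ)).mul (hev hQ)).sub (contDiffOn_snd.mul (hev hR))
  let p₀ : Z × ℝ → ℝ → ℝ := fun p s => p.2 * ∫ σ in (0 : ℝ)..s, A (pathExtend (Γ p) σ)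
  have hp₀ : ∀ p s, HasDerivAt (p₀ p) (p.2 * A (pathExtend (Γ p) s)) s := fun p s =>
    (hasDerivAt_primitive (hAc.comp (continuous_pathExtend _)) s).const_mul _
  have hp₀c : ∀ p, Continuous (p₀ p) := fun p =>
    continuous_iff_continuousAt.2 fun s => (hp₀ p s).continuousAt
  have hQe : ∀ p, ∀ s ∈ Icc (0 : ℝ) 1, pathExtend (Q p) s = Real.exp (p₀ p s) := by
    intro p s hs
    exact pathExtend_coe (Q p) ⟨s, hs⟩
  have hQo : ∀ p, Q p o = Real.exp (p₀ p 1) := fun p => rfl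
  have hRo : ∀ p, R p o =
      ∫ σ in (0 : ℝ)..1, F (pathExtend (Γ p) σ) * Real.exp (p₀ p σ) := by
    intro p
    refine intervalIntegral.integral_congr fun σ hσ => ?_
    rw [uIcc_of_le zero_le_one] at hσ
    change F (pathExtend (Γ p) σ) * pathExtend (Q p) σ = _
    rw [hQe p σ hσ]
  refine ⟨V, hV, ?_, ?_⟩
  · intro τ hτ γ e h he
    have hres : ∀ s ∈ Icc (0 : ℝ) 1, pathExtend (Γ (γ 0, τ)) s = γ s := by
      let η : C(Icc (0 : ℝ) 1, Z) := ⟨fun s => γ s, h.continuousOn_curve.domRestrict⟩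
      have hη : ∀ s ∈ Icc (0 : ℝ) 1, pathExtend η s = γ s := fun s hs => pathExtend_coe η ⟨s, hs⟩
      have : η = Γ (γ 0, τ) := by
        rw [← hΓiff (γ 0, τ) hτ]
        ext s
        rw [ContinuousMap.add_apply, ContinuousMap.smul_apply, constPath_apply, volterra_apply,
          ← intervalIntegral.integral_smul]
        rw [intervalIntegral.integral_eq_sub_of_hasDerivAt_of_le (f := γ) s.2.1
          (h.continuousOn_curve.mono (Icc_subset_Icc_right s.2.2))]
        · change γ s = γ 0 + (γ s - γ 0)
          abel
        · intro σ hσ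
          have hσ' : σ ∈ Ioo (0 : ℝ) 1 := ⟨hσ.1, hσ.2.trans_le s.2.2⟩
          rw [pathExtend_comp, hη σ (Ioo_subset_Icc_self hσ')]
          exact h.hasDerivAt_curve σ hσ'
        · exact ((continuous_pathExtend _).const_smul _).intervalIntegrable _ _
      rw [← this]
      exact hη
    have hΓo : Γ (γ 0, τ) o = γ 1 := by
      rw [← hres 1 (right_mem_Icc.2 zero_le_one)]
      exact (pathExtend_coe _ o).symm
    have hint : ∫ σ in (0 : ℝ)..1,
        τ * (F (pathExtend (Γ (γ 0, τ)) σ) * Real.exp (p₀ (γ 0, τ) σ)) =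
        e 1 * Real.exp (p₀ (γ 0, τ) 1) - e 0 * Real.exp (p₀ (γ 0, τ) 0) := by
      refine intervalIntegral.integral_eq_sub_of_hasDerivAt_of_le
        (f := fun s => e s * Real.exp (p₀ (γ 0, τ) s)) zero_le_one
        (h.continuousOn_value.mul (Real.continuous_exp.comp (hp₀c _)).continuousOn) ?_ ?_
      · intro s hs
        refine ((h.hasDerivAt_value s hs).mul (hp₀ (γ 0, τ) s).exp).congr_deriv ?_
        rw [hres s (Ioo_subset_Icc_self hs)]
        ring
      · exact (continuous_const.mul ((hFc.comp (continuous_pathExtend _)).mul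
          (Real.continuous_exp.comp (hp₀c _)))).intervalIntegrable _ _
    rw [intervalIntegral.integral_const_mul] at hint
    have hz : p₀ (γ 0, τ) 0 = 0 := by simp [p₀]
    rw [hz, Real.exp_zero, mul_one, he] at hint
    simp only [V]
    rw [hQo, hRo, hΓo, hint]
    ring
  · intro z τ hτ
    let q : ℝ → ℝ := fun s => ∫ σ in (0 : ℝ)..s,
      F (pathExtend (Γ (z, τ)) σ) * Real.exp (p₀ (z, τ) σ)
    have hq : ∀ s, HasDerivAt q (F (pathExtend (Γ (z, τ)) s) * Real.exp (p₀ (z, τ) s)) s :=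
      fun s => hasDerivAt_primitive ((hFc.comp (continuous_pathExtend _)).mul
          (Real.continuous_exp.comp (hp₀c _))) s
    let e : ℝ → ℝ := fun s => Real.exp (-p₀ (z, τ) s) * (V (z, τ) + τ * q s)
    have he : ∀ s, HasDerivAt e
        (τ * (F (pathExtend (Γ (z, τ)) s) - A (pathExtend (Γ (z, τ)) s) * e s)) s := by
      intro s
      refine ((hp₀ (z, τ) s).neg.exp.mul (((hq s).const_mul τ).const_add (V (z, τ)))).congr_deriv ?_
      have : Real.exp (-p₀ (z, τ) s) * Real.exp (p₀ (z, τ) s) = 1 := by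
        rw [← Real.exp_add]; simp
      simp only [e, Pi.neg_apply]
      linear_combination (τ * F (pathExtend (Γ (z, τ)) s)) * this
    have hcurve : ∀ s ∈ Icc (0 : ℝ) 1, pathExtend (Γ (z, τ)) s =
        z + τ • ∫ σ in (0 : ℝ)..s, W (pathExtend (Γ (z, τ)) σ) := by
      intro s hs
      have h1 := (hΓiff (z, τ) hτ (Γ (z, τ))).2 rfl
      exact (pathExtend_coe (Γ (z, τ)) ⟨s, hs⟩).trans (DFunLike.congr_fun h1 ⟨s, hs⟩)
    refine ⟨pathExtend (Γ (z, τ)), e, ⟨(continuous_pathExtend _).continuousOn,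
      fun s _ => (he s).continuousAt.continuousWithinAt, ?_, fun s _ => he s⟩, ?_, ?_⟩
    · intro s hs
      refine (((hasDerivAt_primitive (hWc.comp (continuous_pathExtend _)) s).const_smul
        τ).const_add z).congr_of_eventuallyEq ?_
      filter_upwards [Icc_mem_nhds hs.1 hs.2] with σ hσ
      exact hcurve σ hσ
    · have hΓo : pathExtend (Γ (z, τ)) 1 = Γ (z, τ) o := pathExtend_coe _ o
      have : Real.exp (-p₀ (z, τ) 1) * Real.exp (p₀ (z, τ) 1) = 1 := by
        rw [← Real.exp_add]; simp
      simp only [e, V]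
      rw [hΓo, hQo, hRo]
      linear_combination (D (Γ (z, τ) o)) * this
    · rw [hcurve 0 (left_mem_Icc.2 zero_le_one)]
      simp

end Characteristics

section Extension

open Set

variable {F : Type}

/-- Extension of a function on the half space `p.1 ≤ 0` by a weighted sum of its reflections. -/
noncomputable def reflectExtend {G : Type} [AddCommMonoid G] [Module ℝ G] {ι : Type}
    (s : Finset ι) (c m : ι → ℝ) (f : ℝ × F → G) (p : ℝ × F) : G :=
  if p.1 ≤ 0 then f p else ∑ i ∈ s, c i • f (m i * p.1, p.2)

section Reflect

variable {G : Type} [NormedAddCommGroup G] [NormedSpace ℝ G] {ι : Type} {s : Finset ι}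
  {c m : ι → ℝ}

theorem reflectExtend_of_nonpos (f : ℝ × F → G) {p : ℝ × F} (hp : p.1 ≤ 0) :
    reflectExtend s c m f p = f p := if_pos hp

theorem reflectExtend_of_nonneg (f : ℝ × F → G) (hc : ∑ i ∈ s, c i = 1) {p : ℝ × F}
    (hp : 0 ≤ p.1) : reflectExtend s c m f p = ∑ i ∈ s, c i • f (m i * p.1, p.2) := by
  rcases hp.lt_or_eq with h | h
  · exact if_neg h.not_ge
  · have h1 : ∀ i, ((m i * p.1, p.2) : ℝ × F) = p := fun i => by
      rw [← h, mul_zero, h]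
    rw [reflectExtend_of_nonpos f h.ge]
    simp only [h1, ← Finset.sum_smul, hc, one_smul]

variable [NormedAddCommGroup F] [NormedSpace ℝ F]

theorem contDiff_reflectExtend (hm : ∀ i ∈ s, m i ≤ 0) {k : ℕ} {f : ℝ × F → G}
    (hf : ContDiffOn ℝ k f {p | p.1 ≤ 0}) (hc : ∀ j ≤ k, ∑ i ∈ s, c i * m i ^ j = 1) :
    ContDiff ℝ k (reflectExtend s c m f) := by
  have hcl : IsClosed {p : ℝ × F | p.1 ≤ 0} := isClosed_le continuous_fst continuous_const
  have hcl' : IsClosed {p : ℝ × F | 0 ≤ p.1} := isClosed_le continuous_const continuous_fst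
  have hun : {p : ℝ × F | p.1 ≤ 0} ∪ {p : ℝ × F | 0 ≤ p.1} = univ :=
    eq_univ_of_forall fun p => le_total p.1 0
  have hU : UniqueDiffOn ℝ {p : ℝ × F | p.1 ≤ 0} := by
    have := (uniqueDiffOn_Iic (0 : ℝ)).prod (uniqueDiffOn_univ (𝕜 := ℝ) (E := F))
    convert this using 1
    ext p
    simp
  have hmaps : ∀ i ∈ s, MapsTo (fun p : ℝ × F => (m i * p.1, p.2)) {p | 0 ≤ p.1} {p | p.1 ≤ 0} :=
    fun i hi p hp => mul_nonpos_of_nonpos_of_nonneg (hm i hi) hp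
  have hc0 : ∀ {c' : ι → ℝ} {n : ℕ}, (∀ j ≤ n, ∑ i ∈ s, c' i * m i ^ j = 1) →
      ∑ i ∈ s, c' i = 1 := fun h => by simpa using h 0 (Nat.zero_le _)
  induction k generalizing G c with
  | zero =>
    rw [Nat.cast_zero, contDiff_zero, ← continuousOn_univ, ← hun]
    have hfc := hf.continuousOn
    refine ContinuousOn.union_of_isClosed
      (hfc.congr fun p hp => reflectExtend_of_nonpos f hp) ?_ hcl hcl'
    refine ContinuousOn.congr ?_ fun p hp => reflectExtend_of_nonneg f (hc0 hc) hp
    exact continuousOn_finsetSum _ fun i hi =>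
      (hfc.comp (by fun_prop) (hmaps i hi)).const_smul (c i)
  | succ n ih =>
    rw [Nat.cast_succ] at hf
    have hdf : DifferentiableOn ℝ f {p | p.1 ≤ 0} := hf.differentiableOn (by simp)
    have hf' : ContDiffOn ℝ n (fderivWithin ℝ f {p | p.1 ≤ 0}) {p | p.1 ≤ 0} :=
      ((contDiffOn_succ_iff_fderivWithin hU).1 hf).2.2
    set f' := fderivWithin ℝ f {p | p.1 ≤ 0} with hf'_def
    have hd : ∀ p ∈ {p : ℝ × F | p.1 ≤ 0}, HasFDerivWithinAt f (f' p) {p | p.1 ≤ 0} p :=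
      fun p hp => (hdf p hp).hasFDerivWithinAt
    have hf1 : ContDiffOn ℝ n (fun p => f' p (1, 0)) {p | p.1 ≤ 0} :=
      hf'.clm_apply contDiffOn_const
    have hf2 : ContDiffOn ℝ n (fun p => (f' p).comp (ContinuousLinearMap.inr ℝ ℝ F))
        {p | p.1 ≤ 0} := hf'.clm_comp contDiffOn_const
    have hc1 : ∀ j ≤ n, ∑ i ∈ s, (c i * m i) * m i ^ j = 1 := fun j hj => by
      rw [← hc (j + 1) (by omega)]
      exact Finset.sum_congr rfl fun i _ => by ring
    have hc2 : ∀ j ≤ n, ∑ i ∈ s, c i * m i ^ j = 1 := fun j hj => hc j (by omega)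
    have hg1 := ih hf1 hc1
    have hg2 := ih hf2 hc2
    rw [Nat.cast_succ, contDiff_succ_iff_hasFDerivAt]
    refine ⟨fun p => (ContinuousLinearMap.fst ℝ ℝ F).smulRight
        (reflectExtend s (fun i => c i * m i) m (fun p => f' p (1, 0)) p) +
      (reflectExtend s c m (fun p => (f' p).comp (ContinuousLinearMap.inr ℝ ℝ F)) p).comp
        (ContinuousLinearMap.snd ℝ ℝ F), ?_, fun p => ?_⟩
    · exact (contDiff_const.smulRight hg1).add (hg2.clm_comp contDiff_const)
    · rw [← hasFDerivWithinAt_univ, ← hun]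
      refine HasFDerivWithinAt.union ?_ ?_
      · by_cases hp : p ∈ {p : ℝ × F | p.1 ≤ 0}
        · refine HasFDerivWithinAt.congr ?_ (fun q hq => reflectExtend_of_nonpos f hq)
            (reflectExtend_of_nonpos f hp)
          refine (hd p hp).congr_fderiv ?_
          beta_reduce
          rw [reflectExtend_of_nonpos _ hp, reflectExtend_of_nonpos _ hp]
          have h0 : f' p (0, 0) = 0 := map_zero (f' p)
          ext x <;> simp [h0]
        · exact HasFDerivWithinAt.of_notMem_closure (by rwa [hcl.closure_eq])
      · by_cases hp : p ∈ {p : ℝ × F | 0 ≤ p.1}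
        · refine HasFDerivWithinAt.congr ?_ (fun q hq => reflectExtend_of_nonneg f (hc0 hc2) hq)
            (reflectExtend_of_nonneg f (hc0 hc2) hp)
          beta_reduce
          rw [reflectExtend_of_nonneg _ (hc0 hc1) hp, reflectExtend_of_nonneg _ (hc0 hc2) hp]
          have hin : ∀ i : ι, HasFDerivWithinAt (fun p : ℝ × F => (m i * p.1, p.2))
              ((m i • ContinuousLinearMap.fst ℝ ℝ F).prod (ContinuousLinearMap.snd ℝ ℝ F))
              {p | 0 ≤ p.1} p := fun i =>
            ((hasFDerivWithinAt_fst.const_mul (m i)).prodMk hasFDerivWithinAt_snd)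
          have := HasFDerivWithinAt.fun_sum (u := s) fun i hi =>
            ((hd _ (hmaps i hi hp)).comp p (hin i) (hmaps i hi)).const_smul (c i)
          refine this.congr_fderiv ?_
          have h0 : ∀ q : ℝ × F, f' q (0, 0) = 0 := fun q => map_zero (f' q)
          ext x <;> simp [h0]
          refine Finset.sum_congr rfl fun i _ => ?_
          have h1 : ((m i, 0) : ℝ × F) = m i • (1, 0) := by simp
          rw [h1, map_smul, mul_smul]
        · exact HasFDerivWithinAt.of_notMem_closure (by rwa [hcl'.closure_eq])

end Reflect

variable [NormedAddCommGroup F] [NormedSpace ℝ F]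

theorem exists_reflection_weights (k : ℕ) :
    ∃ c : ℕ → ℝ, ∀ j ≤ k, ∑ i ∈ Finset.range (k + 1), c i * (-((i : ℝ) + 1)) ^ j = 1 := by
  have hinj : InjOn (fun i : ℕ => -((i : ℝ) + 1)) (Finset.range (k + 1) : Set ℕ) := by
    intro i _ j _ h
    simpa using h
  refine ⟨fun i => (Lagrange.basis (Finset.range (k + 1)) (fun i : ℕ => -((i : ℝ) + 1)) i).eval 1,
    fun j hj => ?_⟩
  have h := Lagrange.eq_interpolate (f := (Polynomial.X ^ j : Polynomial ℝ)) hinj (by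
    rw [Polynomial.degree_X_pow, Finset.card_range]
    exact_mod_cast Nat.lt_succ_of_le hj)
  have h1 := congrArg (Polynomial.eval 1) h
  rw [Lagrange.interpolate_apply, Polynomial.eval_finsetSum] at h1
  simp only [Polynomial.eval_pow, Polynomial.eval_X, one_pow, Polynomial.eval_mul,
    Polynomial.eval_C] at h1
  exact (Finset.sum_congr rfl fun i _ => mul_comm _ _).trans h1.symm

variable {G : Type} [NormedAddCommGroup G] [NormedSpace ℝ G]

theorem exists_contDiff_extension_halfSpace {k : ℕ} {f : ℝ × F → G}
    (hf : ContDiffOn ℝ k f {p | p.1 ≤ 0}) :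
    ∃ g : ℝ × F → G, ContDiff ℝ k g ∧ EqOn g f {p | p.1 ≤ 0} := by
  obtain ⟨c, hc⟩ := exists_reflection_weights k
  exact ⟨_, contDiff_reflectExtend (fun i _ => by linarith [i.cast_nonneg (α := ℝ)]) hf hc,
    fun p hp => reflectExtend_of_nonpos f hp⟩

theorem exists_contDiff_extension_of_vanishing {k : ℕ} {f : ℝ × F → G} {a b c : ℝ} (hac : a < c)
    (hf : ContDiffOn ℝ k f {p | a ≤ p.1 ∧ p.1 ≤ b}) {φ : ℝ × F → ℝ} (hφ : ContDiff ℝ k φ)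
    (hφ0 : ∀ p : ℝ × F, p.1 ≤ c → φ p = 0) :
    ∃ g : ℝ × F → G, ContDiff ℝ k g ∧
      EqOn g (fun p => φ p • f p) {p | a ≤ p.1 ∧ p.1 ≤ b} := by
  let h : ℝ × F → G := fun p => if a ≤ p.1 then φ p • f p else 0
  have hh : ContDiffOn ℝ k h {p | p.1 ≤ b} := by
    intro p hp
    by_cases hpc : p.1 < c
    · have h0 : h =ᶠ[nhds p] fun _ => 0 := by
        filter_upwards [continuous_fst.continuousAt.eventually (Iio_mem_nhds hpc)] with q hq
        simp [h, hφ0 q (le_of_lt hq)]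
      exact (contDiffAt_const.congr_of_eventuallyEq h0).contDiffWithinAt
    · have hap : a < p.1 := hac.trans_le (not_lt.1 hpc)
      have hev := continuous_fst.continuousAt.eventually (Ioi_mem_nhds hap)
      have h1 : h =ᶠ[nhds p] fun q => φ q • f q := by
        filter_upwards [hev] with q hq
        exact if_pos (le_of_lt hq)
      have h2 := hφ.contDiffAt.contDiffWithinAt.smul (hf p ⟨hap.le, hp⟩)
      refine ContDiffWithinAt.congr_of_eventuallyEq (h2.mono_of_mem_nhdsWithin ?_)
        (h1.filter_mono nhdsWithin_le_nhds) h1.self_of_nhds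
      filter_upwards [self_mem_nhdsWithin, nhdsWithin_le_nhds hev] with q hq hq'
      exact ⟨le_of_lt hq', hq⟩
  obtain ⟨g, hg, hgf⟩ := exists_contDiff_extension_halfSpace
    (f := fun p : ℝ × F => h (p.1 + b, p.2)) (k := k)
    (hh.comp (by fun_prop) fun p (hp : p.1 ≤ 0) => show p.1 + b ≤ b by linarith)
  refine ⟨fun p => g (p.1 - b, p.2), hg.comp (by fun_prop), fun p hp => ?_⟩
  have hpb : p.1 - b ≤ 0 := sub_nonpos.2 hp.2
  simpa [h, hp.1] using hgf (show ((p.1 - b, p.2) : ℝ × F) ∈ {p : ℝ × F | p.1 ≤ 0} from hpb)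

/-- A function which is `Cᵏ` on a slab `a ≤ p.1 ≤ b` is the restriction of a `Cᵏ` function. -/
theorem exists_contDiff_extension_slab {k : ℕ} {f : ℝ × F → G} {a b : ℝ} (hab : a < b)
    (hf : ContDiffOn ℝ k f {p | a ≤ p.1 ∧ p.1 ≤ b}) :
    ∃ g : ℝ × F → G, ContDiff ℝ k g ∧ EqOn g f {p | a ≤ p.1 ∧ p.1 ≤ b} := by
  let χ : ℝ × F → ℝ := fun p => Real.smoothTransition (3 / (b - a) * (p.1 - (2 * a + b) / 3))
  have hχ : ContDiff ℝ k χ := Real.smoothTransition.contDiff.comp (by fun_prop)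
  have hba : 0 < b - a := sub_pos.2 hab
  have hχ0 : ∀ p : ℝ × F, p.1 ≤ (2 * a + b) / 3 → χ p = 0 := fun p hp =>
    Real.smoothTransition.zero_of_nonpos
      (mul_nonpos_of_nonneg_of_nonpos (by positivity) (by linarith))
  have hχ1 : ∀ p : ℝ × F, (a + 2 * b) / 3 ≤ p.1 → χ p = 1 := fun p hp =>
    Real.smoothTransition.one_of_one_le (by
      rw [div_mul_eq_mul_div, le_div_iff₀ hba]; linarith)
  obtain ⟨g₁, hg₁, hgf₁⟩ := exists_contDiff_extension_of_vanishing
    (show a < (2 * a + b) / 3 by linarith) hf hχ hχ0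
  obtain ⟨g₂, hg₂, hgf₂⟩ := exists_contDiff_extension_of_vanishing
    (f := fun p : ℝ × F => f (-p.1, p.2)) (a := -b) (b := -a) (k := k)
    (φ := fun p : ℝ × F => 1 - χ (-p.1, p.2)) (show -b < -((a + 2 * b) / 3) by linarith)
    (hf.comp (by fun_prop) fun p (hp : -b ≤ p.1 ∧ p.1 ≤ -a) =>
      show a ≤ -p.1 ∧ -p.1 ≤ b from ⟨by linarith [hp.2], by linarith [hp.1]⟩)
    (contDiff_const.sub (hχ.comp (by fun_prop)))
    (fun p hp => sub_eq_zero.2 (hχ1 (-p.1, p.2) (show _ ≤ -p.1 by linarith)).symm)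
  refine ⟨fun p => g₁ p + g₂ (-p.1, p.2), hg₁.add (hg₂.comp (by fun_prop)), fun p hp => ?_⟩
  have h₁ := hgf₁ hp
  have h₂ := hgf₂ (x := (-p.1, p.2)) ⟨neg_le_neg hp.2, neg_le_neg hp.1⟩
  simp only [neg_neg, Prod.mk.eta] at h₁ h₂
  beta_reduce
  rw [h₁, h₂, ← add_smul, add_sub_cancel, one_smul]

end Extension

section EuclideanNorm

theorem enorm3_nonneg (x : Fin 3 → ℝ) : 0 ≤ enorm3 x := Real.sqrt_nonneg _

theorem enorm3_sq (x : Fin 3 → ℝ) : enorm3 x ^ 2 = ∑ i, x i ^ 2 :=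
  Real.sq_sqrt (Finset.sum_nonneg fun _ _ => sq_nonneg _)

theorem enorm3_smul (c : ℝ) (x : Fin 3 → ℝ) : enorm3 (c • x) = |c| * enorm3 x := by
  have h : ∑ i, (c • x) i ^ 2 = c ^ 2 * ∑ i, x i ^ 2 := by
    simp only [Pi.smul_apply, smul_eq_mul, mul_pow, Finset.mul_sum]
  rw [enorm3, h, Real.sqrt_mul (sq_nonneg c), Real.sqrt_sq_eq_abs, enorm3]

theorem enorm3_eq_one {x : Fin 3 → ℝ} (h : ∑ i, x i ^ 2 = 1) : enorm3 x = 1 := by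
  rw [enorm3, h, Real.sqrt_one]

theorem enorm3_pos {x : Fin 3 → ℝ} (hx : x ≠ 0) : 0 < enorm3 x := by
  refine Real.sqrt_pos.2 (lt_of_le_of_ne (Finset.sum_nonneg fun _ _ => sq_nonneg _) fun h => hx ?_)
  have h0 := (Finset.sum_eq_zero_iff_of_nonneg fun i _ => sq_nonneg (x i)).1 h.symm
  exact funext fun i => pow_eq_zero_iff two_ne_zero |>.1 (h0 i (Finset.mem_univ i))

theorem ne_zero_of_enorm3_pos {x : Fin 3 → ℝ} (hx : 0 < enorm3 x) : x ≠ 0 := by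
  rintro rfl
  simp [enorm3] at hx

theorem enorm3_inv_smul {x : Fin 3 → ℝ} (hx : 0 < enorm3 x) :
    enorm3 ((enorm3 x)⁻¹ • x) = 1 := by
  rw [enorm3_smul, abs_inv, abs_of_pos hx, inv_mul_cancel₀ hx.ne']

theorem contDiff_sum_sq {n : WithTop ℕ∞} : ContDiff ℝ n fun x : Fin 3 → ℝ => ∑ i, x i ^ 2 := by
  fun_prop

theorem continuous_enorm3 : Continuous enorm3 :=
  Real.continuous_sqrt.comp (contDiff_sum_sq (n := 0)).continuous

theorem contDiffAt_enorm3 {n : WithTop ℕ∞} {x : Fin 3 → ℝ} (hx : x ≠ 0) :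
    ContDiffAt ℝ n enorm3 x := by
  refine contDiff_sum_sq.contDiffAt.sqrt ?_
  rw [← enorm3_sq]
  exact pow_ne_zero 2 (enorm3_pos hx).ne'

theorem norm_le_enorm3 (x : Fin 3 → ℝ) : ‖x‖ ≤ enorm3 x := by
  refine (pi_norm_le_iff_of_nonneg (enorm3_nonneg x)).2 fun i => ?_
  refine Real.abs_le_sqrt ?_
  exact Finset.single_le_sum (fun j _ => sq_nonneg (x j)) (Finset.mem_univ i)

end EuclideanNorm

section Shell

open Set

/-- A `Cᵏ` function on a spherical shell, written in polar coordinates, is the restriction of a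
compactly supported `Cᵏ` function of the radius and a vector. -/
theorem exists_polar_extension {G : Type} [NormedAddCommGroup G] [NormedSpace ℝ G] {k : ℕ}
    {r₀ r₁ : ℝ} (h0 : 0 < r₀) (h01 : r₀ < r₁) {φ : (Fin 3 → ℝ) → G}
    (hφ : ContDiffOn ℝ k φ {x | r₀ ≤ enorm3 x ∧ enorm3 x ≤ r₁}) :
    ∃ Φ : ℝ × (Fin 3 → ℝ) → G, ContDiff ℝ k Φ ∧ HasCompactSupport Φ ∧
      ∀ t y, r₀ ≤ t → t ≤ r₁ → enorm3 y = 1 → Φ (t, y) = φ (t • y) := by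
  let χ : ContDiffBump (1 : ℝ) := ⟨1 / 4, 1 / 2, by norm_num, by norm_num⟩
  let ψ : ℝ × (Fin 3 → ℝ) → G := fun p =>
    χ (∑ i, p.2 i ^ 2) • φ ((p.1 / enorm3 p.2) • p.2)
  have hψ : ContDiffOn ℝ k ψ {p | r₀ ≤ p.1 ∧ p.1 ≤ r₁} := by
    intro p hp
    by_cases hy : p.2 = 0
    · have hev : ∀ᶠ q : ℝ × (Fin 3 → ℝ) in nhds p, ∑ i, q.2 i ^ 2 < 1 / 2 := by
        have hc : Continuous fun q : ℝ × (Fin 3 → ℝ) => ∑ i, q.2 i ^ 2 := by fun_prop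
        exact hc.continuousAt.eventually (Iio_mem_nhds (by simp [hy]))
      have h : ψ =ᶠ[nhds p] fun _ => 0 := by
        filter_upwards [hev] with q hq
        have : χ (∑ i, q.2 i ^ 2) = 0 := χ.zero_of_le_dist (by
          rw [Real.dist_eq, abs_sub_comm]
          exact le_trans (show (1 / 2 : ℝ) ≤ 1 - ∑ i, q.2 i ^ 2 by linarith) (le_abs_self _))
        simp [ψ, this]
      exact (contDiffAt_const.congr_of_eventuallyEq h).contDiffWithinAt
    · have hne : ∀ᶠ q : ℝ × (Fin 3 → ℝ) in nhds p, q.2 ≠ 0 :=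
        continuous_snd.continuousAt.eventually (isOpen_ne.mem_nhds hy)
      have hmaps : MapsTo (fun q : ℝ × (Fin 3 → ℝ) => (q.1 / enorm3 q.2) • q.2)
          ({q | r₀ ≤ q.1 ∧ q.1 ≤ r₁} ∩ {q | q.2 ≠ 0}) {x | r₀ ≤ enorm3 x ∧ enorm3 x ≤ r₁} := by
        rintro q ⟨hq, hq0⟩
        have hpos := enorm3_pos hq0
        have : enorm3 ((q.1 / enorm3 q.2) • q.2) = q.1 := by
          rw [enorm3_smul, abs_of_nonneg (div_nonneg (h0.le.trans hq.1) hpos.le),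
            div_mul_cancel₀ _ hpos.ne']
        rwa [mem_ofPred_eq, this]
      have hin : ContDiffAt ℝ k (fun q : ℝ × (Fin 3 → ℝ) => (q.1 / enorm3 q.2) • q.2) p :=
        (contDiffAt_fst.div ((contDiffAt_enorm3 hy).comp p contDiffAt_snd)
          (enorm3_pos hy).ne').smul contDiffAt_snd
      have h1 := (hφ _ (hmaps ⟨hp, hy⟩)).comp p hin.contDiffWithinAt hmaps
      have h2 : ContDiffAt ℝ k (fun q : ℝ × (Fin 3 → ℝ) => χ (∑ i, q.2 i ^ 2)) p :=
        χ.contDiff.contDiffAt.comp p (by fun_prop)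
      exact (h2.contDiffWithinAt.smul h1).mono_of_mem_nhdsWithin
        (Filter.inter_mem self_mem_nhdsWithin (nhdsWithin_le_nhds hne))
  obtain ⟨g, hg, hgψ⟩ := exists_contDiff_extension_slab h01 hψ
  let θ : ContDiffBump (0 : ℝ × (Fin 3 → ℝ)) :=
    ⟨r₁ + 1, r₁ + 2, by linarith, by linarith⟩
  refine ⟨fun p => θ p • g p, θ.contDiff.smul hg, θ.hasCompactSupport.smul_right,
    fun t y ht ht' hy => ?_⟩
  have hθ : θ (t, y) = 1 := θ.one_of_mem_closedBall (by
    rw [mem_closedBall_zero_iff, Prod.norm_def, max_le_iff]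
    refine ⟨?_, ?_⟩
    · change |t| ≤ r₁ + 1
      rw [abs_of_pos (h0.trans_le ht)]
      linarith
    · change ‖y‖ ≤ r₁ + 1
      linarith [norm_le_enorm3 y])
  have hχ : χ (∑ i, y i ^ 2) = 1 := χ.one_of_mem_closedBall (by
    rw [← enorm3_sq, hy, one_pow]
    exact Metric.mem_closedBall_self (by norm_num))
  have := hgψ (x := (t, y)) ⟨ht, ht'⟩
  simp only [ψ, hχ, hy, div_one, one_smul] at this
  simp [hθ, this]

end Shell

section Transport

open Set

theorem eq_of_hasDerivAt_zero {g : ℝ → ℝ} (hc : ContinuousOn g (Icc 0 1))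
    (hg : ∀ s ∈ Ioo (0 : ℝ) 1, HasDerivAt g 0 s) {s : ℝ} (hs : s ∈ Icc (0 : ℝ) 1) :
    g s = g 0 := by
  rcases hs.1.eq_or_lt with rfl | h
  · rfl
  · obtain ⟨c, -, hc'⟩ := exists_hasDerivAt_eq_slope g (fun _ => 0) h
      (hc.mono (Icc_subset_Icc_right hs.2)) fun x hx => hg x ⟨hx.1, hx.2.trans_le hs.2⟩
    rw [eq_comm, div_eq_zero_iff, sub_eq_zero] at hc'
    exact hc'.resolve_right (by linarith)

theorem HasDerivAt.sum_sq {y : ℝ → Fin 3 → ℝ} {y' : Fin 3 → ℝ} {s : ℝ} (h : HasDerivAt y y' s) :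
    HasDerivAt (fun s => ∑ i, y s i ^ 2) (2 * ∑ i, y' i * y s i) s := by
  have h1 := HasDerivAt.fun_sum (u := Finset.univ) fun i _ => ((hasDerivAt_pi.1 h) i).fun_pow 2
  refine h1.congr_deriv ?_
  rw [Finset.mul_sum]
  exact Finset.sum_congr rfl fun i _ => by push_cast; ring

/-- The radial component of a vector field. -/
noncomputable def radialPart (u : (Fin 3 → ℝ) → Fin 3 → ℝ) (x : Fin 3 → ℝ) : ℝ :=
  (∑ i, u x i * x i) / enorm3 x

/-- A curve of `u` starting at `x`, parametrized affinely by the radius, which runs from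
`enorm3 x` at time `0` to `r₀` at time `1`. -/
structure IsRadialCurve (u : (Fin 3 → ℝ) → Fin 3 → ℝ) (r₀ : ℝ) (x : Fin 3 → ℝ)
    (X : ℝ → Fin 3 → ℝ) : Prop where
  start : X 0 = x
  continuousOn : ContinuousOn X (Icc 0 1)
  radius : ∀ s ∈ Icc (0 : ℝ) 1, enorm3 (X s) = enorm3 x + s * (r₀ - enorm3 x)
  hasDerivAt : ∀ s ∈ Ioo (0 : ℝ) 1,
    HasDerivAt X (((r₀ - enorm3 x) / radialPart u (X s)) • u (X s)) s

/-- The transport equation with coefficient `a` and source `f`, restricted to a curve `X` moving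
with speed `τ` relative to the radial component of `u`. -/
def SolvesAlong (u : (Fin 3 → ℝ) → Fin 3 → ℝ) (a f : (Fin 3 → ℝ) → ℝ) (τ : ℝ)
    (X : ℝ → Fin 3 → ℝ) (e : ℝ → ℝ) : Prop :=
  ContinuousOn e (Icc 0 1) ∧ ∀ s ∈ Ioo (0 : ℝ) 1,
    HasDerivAt e (τ / radialPart u (X s) * (f (X s) - a (X s) * e s)) s

theorem exists_contDiffOn_value_along {r₀ r₁ δ : ℝ} {k : ℕ} (hk : 1 ≤ k) (h0 : 0 < r₀)
    (h01 : r₀ < r₁) (hδ : 0 < δ) {u : (Fin 3 → ℝ) → Fin 3 → ℝ} {a f E₀ : (Fin 3 → ℝ) → ℝ}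
    (hu : ContDiffOn ℝ k u {x | r₀ ≤ enorm3 x ∧ enorm3 x ≤ r₁})
    (hrad : ∀ x, r₀ ≤ enorm3 x → enorm3 x ≤ r₁ → δ ≤ radialPart u x)
    (ha : ContDiffOn ℝ k a {x | r₀ ≤ enorm3 x ∧ enorm3 x ≤ r₁})
    (hf : ContDiffOn ℝ k f {x | r₀ ≤ enorm3 x ∧ enorm3 x ≤ r₁})
    (hE₀ : ContDiff ℝ k E₀) :
    ∃ E : (Fin 3 → ℝ) → ℝ, ContDiffOn ℝ k E {x | r₀ ≤ enorm3 x ∧ enorm3 x ≤ r₁} ∧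
      ∀ x, r₀ ≤ enorm3 x → enorm3 x ≤ r₁ → ∃ X e, IsRadialCurve u r₀ x X ∧
        SolvesAlong u a f (r₀ - enorm3 x) X e ∧ e 1 = E₀ (X 1) ∧
        (∀ t ∈ Ico (0 : ℝ) 1, E (X t) = e t) ∧
        ∀ e', SolvesAlong u a f (r₀ - enorm3 x) X e' → e' 1 = E₀ (X 1) → E x = e' 0 := by
  set S : Set (Fin 3 → ℝ) := {x | r₀ ≤ enorm3 x ∧ enorm3 x ≤ r₁} with hS
  have hSpos : ∀ x ∈ S, 0 < enorm3 x := fun x hx => h0.trans_le hx.1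
  have hSne : ∀ x ∈ S, x ≠ 0 := fun x hx => ne_zero_of_enorm3_pos (hSpos x hx)
  have hcpos : ∀ x ∈ S, 0 < radialPart u x := fun x hx => hδ.trans_le (hrad x hx.1 hx.2)
  have hr : ContDiffOn ℝ k enorm3 S := fun x hx => (contDiffAt_enorm3 (hSne x hx)).contDiffWithinAt
  have hrinv : ContDiffOn ℝ k (fun x => (enorm3 x)⁻¹) S := hr.inv fun x hx => (hSpos x hx).ne'
  have hu' : ∀ i, ContDiffOn ℝ k (fun x => u x i) S := contDiffOn_pi.1 hu
  have hc : ContDiffOn ℝ k (radialPart u) S :=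
    (ContDiffOn.sum fun i _ => (hu' i).mul (by fun_prop)).div hr fun x hx => (hSpos x hx).ne'
  have hcinv : ContDiffOn ℝ k (fun x => (radialPart u x)⁻¹) S :=
    hc.inv fun x hx => (hcpos x hx).ne'
  -- the angular velocity of the curves, with respect to the radius
  have hv : ContDiffOn ℝ k (fun x => (enorm3 x)⁻¹ • ((radialPart u x)⁻¹ • u x -
      (enorm3 x)⁻¹ • x)) S := hrinv.smul ((hcinv.smul hu).sub (hrinv.smul contDiffOn_id))
  obtain ⟨V₀, hV₀, hV₀c, hV₀eq⟩ := exists_polar_extension h0 h01 hv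
  obtain ⟨A, hA, -, hAeq⟩ := exists_polar_extension h0 h01 (hcinv.mul ha)
  obtain ⟨F, hF, -, hFeq⟩ := exists_polar_extension h0 h01 (hcinv.mul hf)
  let V : ℝ × (Fin 3 → ℝ) → Fin 3 → ℝ := fun p =>
    (∑ i, p.2 i ^ 2) • V₀ p - (∑ i, V₀ p i * p.2 i) • p.2
  have hV₀i : ∀ i, ContDiff ℝ k fun p => V₀ p i := contDiff_pi.1 hV₀
  have hV : ContDiff ℝ k V :=
    ((contDiff_sum_sq.comp contDiff_snd).smul hV₀).sub
      ((ContDiff.sum fun i _ => (hV₀i i).mul ((contDiff_apply ℝ ℝ i).comp contDiff_snd)).smul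
        contDiff_snd)
  have hVc : HasCompactSupport V := hV₀c.mono fun p hp h => hp (by simp [V, h])
  have hVorth : ∀ p, ∑ i, V p i * p.2 i = 0 := fun p => by
    simp only [V, Pi.sub_apply, Pi.smul_apply, smul_eq_mul, Fin.sum_univ_three]
    ring
  have hVeq : ∀ t y, r₀ ≤ t → t ≤ r₁ → enorm3 y = 1 →
      V (t, y) = t⁻¹ • ((radialPart u (t • y))⁻¹ • u (t • y) - y) := by
    intro t y ht0 ht1 hy
    have ht : 0 < t := h0.trans_le ht0
    have hn : enorm3 (t • y) = t := by rw [enorm3_smul, hy, mul_one, abs_of_pos ht]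
    have hcy := hcpos (t • y) ⟨by rwa [hn], by rwa [hn]⟩
    have hcu : ∑ i, u (t • y) i * y i = radialPart u (t • y) := by
      rw [radialPart, hn, eq_div_iff ht.ne', Finset.sum_mul]
      exact Finset.sum_congr rfl fun i _ => by rw [Pi.smul_apply, smul_eq_mul]; ring
    have hy2 : ∑ i, y i ^ 2 = 1 := by rw [← enorm3_sq, hy, one_pow]
    have h1 : V₀ (t, y) = t⁻¹ • ((radialPart u (t • y))⁻¹ • u (t • y) - y) := by
      rw [hV₀eq t y ht0 ht1 hy, hn, inv_smul_smul₀ ht.ne']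
    have h2 : ∑ i, V₀ (t, y) i * y i = 0 := by
      have h3 : ∑ i, V₀ (t, y) i * y i = t⁻¹ * ((radialPart u (t • y))⁻¹ *
          (∑ i, u (t • y) i * y i) - ∑ i, y i ^ 2) := by
        rw [h1]
        simp only [Pi.smul_apply, Pi.sub_apply, smul_eq_mul, Fin.sum_univ_three]
        ring
      rw [h3, hcu, hy2, inv_mul_cancel₀ hcy.ne', sub_self, mul_zero]
    simp only [V, h2, hy2, one_smul, zero_smul, sub_zero]
    exact h1
  obtain ⟨K, hK⟩ := hV.lipschitzWith_of_hasCompactSupport hVc (by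
    exact_mod_cast (Nat.one_le_iff_ne_zero.1 hk))
  let W : ℝ × (Fin 3 → ℝ) → ℝ × (Fin 3 → ℝ) := fun p => (1, V p)
  have hW : ContDiff ℝ k W := contDiff_const.prodMk hV
  have hWL : LipschitzWith (max 0 K) W := (LipschitzWith.const 1).prodMk hK
  obtain ⟨Q, hQ, hQeq, hQex⟩ := exists_contDiffOn_characteristic_value hk hW hWL hA hF
    (D := fun p => E₀ (r₀ • p.2)) (hE₀.comp (by fun_prop)) (T := r₁ - r₀ + 1) (by linarith)
  have hT : ∀ x ∈ S, |r₀ - enorm3 x| < r₁ - r₀ + 1 := fun x hx => by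
    rw [abs_lt]
    constructor <;> linarith [hx.1, hx.2]
  refine ⟨fun x => Q ((enorm3 x, (enorm3 x)⁻¹ • x), r₀ - enorm3 x), ?_, fun x hx0 hx1 => ?_⟩
  · exact hQ.comp ((hr.prodMk (hrinv.smul contDiffOn_id)).prodMk (contDiffOn_const.sub hr)) hT
  have hxS : x ∈ S := ⟨hx0, hx1⟩
  set r := enorm3 x with hr_def
  have hr0 : 0 < r := hSpos x hxS
  obtain ⟨γ, e, hγ, he1, hγ0⟩ := hQex (r, r⁻¹ • x) (r₀ - r) (hT x hxS)
  have hγ1c : ContinuousOn (fun s => (γ s).1) (Icc 0 1) :=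
    continuous_fst.comp_continuousOn hγ.continuousOn_curve
  have hγ2c : ContinuousOn (fun s => (γ s).2) (Icc 0 1) :=
    continuous_snd.comp_continuousOn hγ.continuousOn_curve
  have hγ1d : ∀ s ∈ Ioo (0 : ℝ) 1, HasDerivAt (fun s => (γ s).1) (r₀ - r) s := fun s hs => by
    have := (hasFDerivAt_fst (𝕜 := ℝ) (p := γ s)).comp_hasDerivAt s (hγ.hasDerivAt_curve s hs)
    exact this.congr_deriv (by simp [W])
  have hγ2d : ∀ s ∈ Ioo (0 : ℝ) 1, HasDerivAt (fun s => (γ s).2) ((r₀ - r) • V (γ s)) s :=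
    fun s hs => by
      have := (hasFDerivAt_snd (𝕜 := ℝ) (p := γ s)).comp_hasDerivAt s (hγ.hasDerivAt_curve s hs)
      exact this.congr_deriv (by simp [W])
  have hγ1 : ∀ s ∈ Icc (0 : ℝ) 1, (γ s).1 = r + s * (r₀ - r) := fun s hs => by
    have := eq_of_hasDerivAt_zero (g := fun s => (γ s).1 - s * (r₀ - r))
      (hγ1c.sub (by fun_prop)) (fun s hs => ((hγ1d s hs).sub
        ((hasDerivAt_id s).mul_const (r₀ - r))).congr_deriv (by simp)) hs
    simp only [hγ0] at this
    linarith
  have hγ2 : ∀ s ∈ Icc (0 : ℝ) 1, enorm3 (γ s).2 = 1 := fun s hs => by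
    have := eq_of_hasDerivAt_zero (g := fun s => ∑ i, (γ s).2 i ^ 2)
      (contDiff_sum_sq (n := 0).continuous.comp_continuousOn hγ2c)
      (fun s hs => (hγ2d s hs).sum_sq.congr_deriv (by
        simp only [Pi.smul_apply, smul_eq_mul, mul_assoc, ← Finset.mul_sum, hVorth, mul_zero])) hs
    refine enorm3_eq_one (this.trans ?_)
    rw [hγ0, ← enorm3_sq, enorm3_inv_smul hr0, one_pow]
  have hbd : ∀ s ∈ Icc (0 : ℝ) 1, r₀ ≤ (γ s).1 ∧ (γ s).1 ≤ r₁ := fun s hs => by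
    rw [hγ1 s hs]
    constructor <;> nlinarith [hs.1, hs.2]
  let X : ℝ → Fin 3 → ℝ := fun s => (γ s).1 • (γ s).2
  have hXr : ∀ s ∈ Icc (0 : ℝ) 1, enorm3 (X s) = (γ s).1 := fun s hs => by
    rw [enorm3_smul, hγ2 s hs, mul_one, abs_of_pos (h0.trans_le (hbd s hs).1)]
  have hX0 : X 0 = x := by simp [X, hγ0, hr0.ne']
  have hX1 : X 1 = r₀ • (γ 1).2 := by
    simp [X, hγ1 1 (right_mem_Icc.2 zero_le_one)]
  have hchar : ∀ e', SolvesAlong u a f (r₀ - r) X e' ↔ ContinuousOn e' (Icc 0 1) ∧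
      ∀ s ∈ Ioo (0 : ℝ) 1, HasDerivAt e' ((r₀ - r) * (F (γ s) - A (γ s) * e' s)) s := fun e' => by
    refine and_congr_right fun _ => forall₂_congr fun s hs => ?_
    have hs' := Ioo_subset_Icc_self hs
    have h1 : F (γ s) = _ := hFeq _ _ (hbd s hs').1 (hbd s hs').2 (hγ2 s hs')
    have h2 : A (γ s) = _ := hAeq _ _ (hbd s hs').1 (hbd s hs').2 (hγ2 s hs')
    have h3 : (r₀ - r) * (F (γ s) - A (γ s) * e' s) =
        (r₀ - r) / radialPart u (X s) * (f (X s) - a (X s) * e' s) := by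
      rw [h1, h2, div_eq_mul_inv]
      ring
    rw [h3]
  refine ⟨X, e, ⟨hX0, hγ1c.smul hγ2c, fun s hs => (hXr s hs).trans (hγ1 s hs), fun s hs => ?_⟩,
    (hchar e).2 ⟨hγ.continuousOn_value, hγ.hasDerivAt_value⟩, by rw [he1, hX1], fun t ht => ?_,
    fun e' he' he'1 => ?_⟩
  · have hs' := Ioo_subset_Icc_self hs
    have h1 : V (γ s) = _ := hVeq _ _ (hbd s hs').1 (hbd s hs').2 (hγ2 s hs')
    have hpos : (γ s).1 ≠ 0 := (h0.trans_le (hbd s hs').1).ne'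
    refine ((hγ1d s hs).smul (hγ2d s hs)).congr_deriv ?_
    rw [h1]
    ext i
    simp only [Pi.add_apply, Pi.smul_apply, Pi.sub_apply, smul_eq_mul, X]
    field_simp
    ring
  · have ht' := Ico_subset_Icc_self ht
    have h := hQeq ((1 - t) * (r₀ - r)) ?_ _ _ (hγ.comp_affine ht) (by simpa using he1)
    · simp only [mul_zero, add_zero] at h
      beta_reduce
      rw [← h, hXr t ht']
      congr 1
      refine Prod.ext (Prod.ext rfl ?_) ?_
      · exact inv_smul_smul₀ (h0.trans_le (hbd t ht').1).ne' _
      · change r₀ - (γ t).1 = _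
        rw [hγ1 t ht']
        ring
    · refine lt_of_le_of_lt ?_ (hT x hxS)
      rw [abs_mul]
      refine mul_le_of_le_one_left (abs_nonneg _) ?_
      rw [abs_of_nonneg] <;> linarith [ht.1, ht.2]
  · have h := hQeq (r₀ - r) (hT x hxS) γ e'
      ⟨hγ.continuousOn_curve, he'.1, hγ.hasDerivAt_curve, ((hchar e').1 he').2⟩
      (by rw [he'1, hX1])
    rw [← h, hγ0]

theorem sum_mul_pd (g : (Fin 3 → ℝ) → ℝ) (x v : Fin 3 → ℝ) :
    ∑ j, v j * pd j g x = fderiv ℝ g x v := by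
  conv_rhs => rw [pi_eq_sum_univ' v]
  simp [pd]

end Transport

/-- Solvability and regularity of the Cauchy problem for a linear transport equation
`u·∇E + aE = f` on the spherical shell (Theorem 6.1): if the radial component of the
`Cᵏ` velocity field is bounded below by `δ > 0`, there is exactly one `Cᵏ` solution
attaining the given data on the inner sphere. -/
theorem transport_equation_solvability
    (r₀ r₁ δ : ℝ) (k : ℕ) (hk : 1 ≤ k)
    (h0 : 0 < r₀) (h01 : r₀ < r₁) (hδ : 0 < δ)
    (u : (Fin 3 → ℝ) → Fin 3 → ℝ) (a f E₀ : (Fin 3 → ℝ) → ℝ)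
    (hu : ContDiffOn ℝ k u {x | r₀ ≤ enorm3 x ∧ enorm3 x ≤ r₁})
    (hrad : ∀ x ∈ {x : Fin 3 → ℝ | r₀ ≤ enorm3 x ∧ enorm3 x ≤ r₁},
      δ ≤ (∑ i, u x i * x i) / enorm3 x)
    (ha : ContDiffOn ℝ k a {x | r₀ ≤ enorm3 x ∧ enorm3 x ≤ r₁})
    (hf : ContDiffOn ℝ k f {x | r₀ ≤ enorm3 x ∧ enorm3 x ≤ r₁})
    (hE₀ : ContDiff ℝ k E₀) :
    ∃ E : (Fin 3 → ℝ) → ℝ,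
      (ContDiffOn ℝ k E {x | r₀ ≤ enorm3 x ∧ enorm3 x ≤ r₁} ∧
       (∀ x ∈ {x : Fin 3 → ℝ | r₀ < enorm3 x ∧ enorm3 x < r₁},
         (∑ j, u x j * pd j E x) + a x * E x = f x) ∧
       (∀ x, enorm3 x = r₀ → E x = E₀ x)) ∧
      ∀ E' : (Fin 3 → ℝ) → ℝ,
        (ContDiffOn ℝ k E' {x | r₀ ≤ enorm3 x ∧ enorm3 x ≤ r₁} ∧
         (∀ x ∈ {x : Fin 3 → ℝ | r₀ < enorm3 x ∧ enorm3 x < r₁},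
           (∑ j, u x j * pd j E' x) + a x * E' x = f x) ∧
         (∀ x, enorm3 x = r₀ → E' x = E₀ x)) →
        ∀ x ∈ {x : Fin 3 → ℝ | r₀ ≤ enorm3 x ∧ enorm3 x ≤ r₁}, E' x = E x := by
  have hopen : IsOpen {x : Fin 3 → ℝ | r₀ < enorm3 x ∧ enorm3 x < r₁} :=
    (isOpen_lt continuous_const continuous_enorm3).inter
      (isOpen_lt continuous_enorm3 continuous_const)
  have hsub : {x : Fin 3 → ℝ | r₀ < enorm3 x ∧ enorm3 x < r₁} ⊆
      {x | r₀ ≤ enorm3 x ∧ enorm3 x ≤ r₁} := fun x hx => ⟨hx.1.le, hx.2.le⟩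
  have hk1 : (1 : WithTop ℕ∞) ≤ k := by exact_mod_cast hk
  have hdiff : ∀ {E : (Fin 3 → ℝ) → ℝ}, ContDiffOn ℝ k E {x | r₀ ≤ enorm3 x ∧ enorm3 x ≤ r₁} →
      ∀ {x}, r₀ < enorm3 x → enorm3 x < r₁ → HasFDerivAt E (fderiv ℝ E x) x :=
    fun {E} hE {x} h h' => (((hE.mono hsub).contDiffAt (hopen.mem_nhds ⟨h, h'⟩)).differentiableAt
      (zero_lt_one.trans_le hk1).ne').hasFDerivAt
  have hcpos : ∀ x, r₀ ≤ enorm3 x → enorm3 x ≤ r₁ → 0 < radialPart u x :=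
    fun x h h' => hδ.trans_le (hrad x ⟨h, h'⟩)
  obtain ⟨E, hE, hchar⟩ := exists_contDiffOn_value_along hk h0 h01 hδ hu
    (fun x h h' => hrad x ⟨h, h'⟩) ha hf hE₀
  have hinit : ∀ x, enorm3 x = r₀ → E x = E₀ x := by
    intro x hx
    obtain ⟨X, e, hX, he, he1, hEX, -⟩ := hchar x hx.ge (hx.trans_lt h01).le
    have hX1 : X 1 = X 0 := by
      ext i
      refine eq_of_hasDerivAt_zero (g := fun s => X s i)
        ((continuous_apply i).comp_continuousOn hX.continuousOn) (fun s hs => ?_)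
        (Set.right_mem_Icc.2 zero_le_one)
      exact ((hasDerivAt_pi.1 (hX.hasDerivAt s hs)) i).congr_deriv (by simp [hx])
    have he10 : e 1 = e 0 := eq_of_hasDerivAt_zero he.1
      (fun s hs => (he.2 s hs).congr_deriv (by simp [hx])) (Set.right_mem_Icc.2 zero_le_one)
    have h := hEX 0 ⟨le_rfl, zero_lt_one⟩
    rw [hX.start] at h
    rw [h, ← he10, he1, hX1, hX.start]
  have hinterior : ∀ {x X}, r₀ < enorm3 x → enorm3 x ≤ r₁ → IsRadialCurve u r₀ x X →
      ∀ s ∈ Set.Ioo (0 : ℝ) 1, r₀ < enorm3 (X s) ∧ enorm3 (X s) < r₁ := by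
    intro x X hx hx' hX s hs
    rw [hX.radius s (Set.Ioo_subset_Icc_self hs)]
    constructor <;> nlinarith [hs.1, hs.2]
  refine ⟨E, ⟨hE, ?_, hinit⟩, ?_⟩
  · rintro x ⟨hx, hx'⟩
    obtain ⟨X, e, hX, he, -, hEX, -⟩ := hchar x hx.le hx'.le
    let R : (Fin 3 → ℝ) → ℝ := fun y => fderiv ℝ E y (u y) + a y * E y - f y
    have hR : ContinuousOn R {x | r₀ < enorm3 x ∧ enorm3 x < r₁} :=
      (((((hE.mono hsub).continuousOn_fderiv_of_isOpen hopen hk1).clm_apply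
        (hu.continuousOn.mono hsub)).add ((ha.continuousOn.mono hsub).mul
        (hE.continuousOn.mono hsub)))).sub (hf.continuousOn.mono hsub)
    have hzero : ∀ s ∈ Set.Ioo (0 : ℝ) 1, R (X s) = 0 := by
      intro s hs
      obtain ⟨h1, h2⟩ := hinterior hx hx'.le hX s hs
      have hd := (hdiff hE h1 h2).comp_hasDerivAt s (hX.hasDerivAt s hs)
      have hev : E ∘ X =ᶠ[nhds s] e := by
        filter_upwards [isOpen_Ioo.mem_nhds hs] with t ht
        exact hEX t (Set.Ioo_subset_Ico_self ht)
      have huniq := (hd.congr_of_eventuallyEq hev.symm).unique (he.2 s hs)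
      rw [map_smul, smul_eq_mul, ← hEX s (Set.Ioo_subset_Ico_self hs)] at huniq
      have hne : (r₀ - enorm3 x) / radialPart u (X s) ≠ 0 :=
        div_ne_zero (sub_neg.2 hx).ne (hcpos _ h1.le h2.le).ne'
      have := mul_left_cancel₀ hne huniq
      simp only [R, this]
      ring
    have hXt : Filter.Tendsto X (nhdsWithin 0 (Set.Ioo 0 1)) (nhds x) := by
      have := (hX.continuousOn 0 (Set.left_mem_Icc.2 zero_le_one)).mono Set.Ioo_subset_Icc_self
      rwa [ContinuousWithinAt, hX.start] at this
    have hRt : Filter.Tendsto (fun s => R (X s)) (nhdsWithin 0 (Set.Ioo 0 1)) (nhds (R x)) :=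
      (hR.continuousAt (hopen.mem_nhds ⟨hx, hx'⟩)).tendsto.comp hXt
    have hRt0 : Filter.Tendsto (fun s => R (X s)) (nhdsWithin 0 (Set.Ioo 0 1)) (nhds 0) :=
      tendsto_const_nhds.congr' (by
        filter_upwards [self_mem_nhdsWithin] with s hs
        exact (hzero s hs).symm)
    have : (nhdsWithin (0 : ℝ) (Set.Ioo 0 1)).NeBot := left_nhdsWithin_Ioo_neBot zero_lt_one
    have h := tendsto_nhds_unique hRt hRt0
    rw [sum_mul_pd]
    exact sub_eq_zero.1 h
  · rintro E' ⟨hE', hpde, hinit'⟩ x ⟨hx, hx'⟩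
    rcases hx.eq_or_lt with h | hlt
    · rw [hinit x h.symm, hinit' x h.symm]
    · obtain ⟨X, e, hX, -, -, -, hval⟩ := hchar x hx hx'
      have hmaps : Set.MapsTo X (Set.Icc 0 1) {x | r₀ ≤ enorm3 x ∧ enorm3 x ≤ r₁} := by
        intro s hs
        change r₀ ≤ enorm3 (X s) ∧ enorm3 (X s) ≤ r₁
        rw [hX.radius s hs]
        constructor <;> nlinarith [hs.1, hs.2]
      have hsolves : SolvesAlong u a f (r₀ - enorm3 x) X (E' ∘ X) := by
        refine ⟨hE'.continuousOn.comp hX.continuousOn hmaps, fun s hs => ?_⟩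
        have hXs := hinterior hlt hx' hX s hs
        refine ((hdiff hE' hXs.1 hXs.2).comp_hasDerivAt s (hX.hasDerivAt s hs)).congr_deriv ?_
        have := hpde _ hXs
        rw [sum_mul_pd] at this
        rw [map_smul, smul_eq_mul, Function.comp_apply, ← this, add_sub_cancel_right]
      have hend : enorm3 (X 1) = r₀ := by
        rw [hX.radius 1 (Set.right_mem_Icc.2 zero_le_one)]
        ring
      rw [hval _ hsolves (hinit' _ hend), Function.comp_apply, hX.start]
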